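/- Appell (conformal) transformation: if u(y,s) solves ∂_s u = i(Δu + V(y,s)u + F(y,s)) on ℝⁿ × [0,1] and α, β > 0, then the function ũ(x,t) = (√(αβ)/(α(1-t)+βt))^{n/2} u(√(αβ)x/(α(1-t)+βt), βt/(α(1-t)+βt)) e^{(α-β)|x|²/(4i(α(1-t)+βt))} solves ∂_t ũ = i(Δũ + Ṽ(x,t)ũ + F̃(x,t)) on ℝⁿ × [0,1], where Ṽ(x,t) = αβ/(α(1-t)+βt)² V(√(αβ)x/(α(1-t)+βt), βt/(α(1-t)+βt)) and F̃ is the analogously transformed forcing term with extra factor (√(αβ)/(α(1-t)+βt))². -/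

import Mathlib

open MeasureTheory Complex Set

/-- Second partial derivative of `u` in the `i`-th coordinate direction. -/
noncomputable def secondPartial (n : ℕ) (u : (Fin n → ℝ) → ℂ) (i : Fin n)
    (y : Fin n → ℝ) : ℂ :=
  iteratedDeriv 2 (fun h : ℝ => u (Function.update y i h)) (y i)

/-- The (spatial) Laplacian of `u`. -/
noncomputable def lap (n : ℕ) (u : (Fin n → ℝ) → ℂ) (y : Fin n → ℝ) : ℂ :=
  ∑ i, secondPartial n u i y

lemma appell_oneD (g : ℝ → ℂ) (hg : ContDiff ℝ 2 g) (c : ℝ) (A κ S : ℂ) (h : ℝ) :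
    iteratedDeriv 2 (fun h : ℝ => A * g (c * h) * Complex.exp (κ * (S + (h:ℂ)^2))) h =
      A * Complex.exp (κ * (S + (h:ℂ)^2)) *
        ((c:ℂ)^2 * iteratedDeriv 2 g (c * h) + 4 * κ * h * c * deriv g (c * h)
          + (2 * κ + 4 * κ^2 * h^2) * g (c * h)) := by
  have hg1 : Differentiable ℝ g := hg.differentiable (by norm_num)
  have hg2 : Differentiable ℝ (deriv g) := by
    have := hg.differentiable_iteratedDeriv 1 (by norm_num)
    simpa [iteratedDeriv_one] using this
  have hlin : ∀ h : ℝ, HasDerivAt (fun h : ℝ => c * h) c h := fun h => by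
    simpa using (hasDerivAt_id h).const_mul c
  have d1 : ∀ h : ℝ, HasDerivAt (fun h : ℝ => g (c * h)) ((c:ℂ) * deriv g (c * h)) h := fun h => by
    have := (hg1 (c * h)).hasDerivAt.scomp h (hlin h)
    simpa [Function.comp_def] using this
  have d2 : ∀ h : ℝ, HasDerivAt (fun h : ℝ => deriv g (c * h))
      ((c:ℂ) * iteratedDeriv 2 g (c * h)) h := fun h => by
    have := (hg2 (c * h)).hasDerivAt.scomp h (hlin h)
    simpa [Function.comp_def, iteratedDeriv_succ, iteratedDeriv_one] using this
  have dc : ∀ h : ℝ, HasDerivAt (fun h : ℝ => (h:ℂ)) 1 h := fun h => Complex.ofRealCLM.hasDerivAt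
  have de : ∀ h : ℝ, HasDerivAt (fun h : ℝ => Complex.exp (κ * (S + (h:ℂ)^2)))
      (Complex.exp (κ * (S + (h:ℂ)^2)) * (κ * (2 * h))) h := fun h => by
    have := ((((dc h).pow 2).const_add S).const_mul κ).cexp
    refine this.congr_deriv ?_
    simp [Pi.pow_apply]
  have e1 : deriv (fun h : ℝ => A * g (c * h) * Complex.exp (κ * (S + (h:ℂ)^2))) =
      fun h : ℝ => A * ((c:ℂ) * deriv g (c * h)) * Complex.exp (κ * (S + (h:ℂ)^2)) +
        A * g (c * h) * (Complex.exp (κ * (S + (h:ℂ)^2)) * (κ * (2 * h))) := by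
    funext h
    exact (((d1 h).const_mul A).mul (de h)).deriv
  rw [iteratedDeriv_succ, iteratedDeriv_one, e1]
  have := ((((d2 h).const_mul (c:ℂ)).const_mul A).mul (de h)).add
    (((d1 h).const_mul A).mul ((de h).mul (((dc h).const_mul 2).const_mul κ)))
  refine (HasDerivAt.deriv this).trans ?_
  simp only [Pi.mul_apply]
  ring

/-- Appell (conformal) transformation. -/
theorem appell_transformation
    (n : ℕ) (u V F : (Fin n → ℝ) → ℝ → ℂ)
    (hu : ContDiff ℝ (⊤ : ℕ∞) (fun p : (Fin n → ℝ) × ℝ => u p.1 p.2))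
    (huV : ∀ y s, s ∈ Icc (0:ℝ) 1 →
      deriv (fun s' => u y s') s =
        Complex.I * (lap n (fun y' => u y' s) y + V y s * u y s + F y s))
    (α β : ℝ) (hα : 0 < α) (hβ : 0 < β)
    (a : ℝ → ℝ) (ha : ∀ t, a t = α * (1 - t) + β * t)
    (utld Vtld Ftld : (Fin n → ℝ) → ℝ → ℂ)
    (hutld : ∀ x t, utld x t =
      ((Real.sqrt (α * β) / a t) ^ ((n : ℝ) / 2) : ℝ) *
        u (fun i => Real.sqrt (α * β) * x i / a t) (β * t / a t) *
        Complex.exp (((α : ℂ) - β) * (∑ i, (x i : ℂ) ^ 2) /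
          (4 * Complex.I * (a t : ℂ))))
    (hVtld : ∀ x t, Vtld x t =
      ((α * β / (a t) ^ 2 : ℝ) : ℂ) *
        V (fun i => Real.sqrt (α * β) * x i / a t) (β * t / a t))
    (hFtld : ∀ x t, Ftld x t =
      ((Real.sqrt (α * β) / a t) ^ ((n : ℝ) / 2 + 2) : ℝ) *
        F (fun i => Real.sqrt (α * β) * x i / a t) (β * t / a t) *
        Complex.exp (((α : ℂ) - β) * (∑ i, (x i : ℂ) ^ 2) /
          (4 * Complex.I * (a t : ℂ)))) :
    ∀ x t, t ∈ Icc (0:ℝ) 1 →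
      deriv (fun τ => utld x τ) t =
        Complex.I * (lap n (fun x' => utld x' t) x + Vtld x t * utld x t + Ftld x t) := by
  intro x t ht
  obtain ⟨ht0, ht1⟩ := ht
  have hat : 0 < a t := by
    rw [ha]
    rcases eq_or_lt_of_le ht0 with h | h
    · rw [← h]; simpa using hα
    · have := mul_pos hβ h
      have := mul_nonneg hα.le (sub_nonneg.2 ht1)
      linarith
  have hat' : a t ≠ 0 := hat.ne'
  set γ := Real.sqrt (α * β) with hγ
  have hγ0 : 0 < γ := Real.sqrt_pos.2 (mul_pos hα hβ)
  have hγ2 : γ ^ 2 = α * β := Real.sq_sqrt (mul_pos hα hβ).le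
  have hs : β * t / a t ∈ Icc (0:ℝ) 1 := by
    constructor
    · positivity
    · rw [div_le_one hat, ha]
      have := mul_nonneg hα.le (sub_nonneg.2 ht1)
      linarith
  set s := β * t / a t with hsdef
  set y : Fin n → ℝ := fun i => γ * x i / a t with hy
  have heq := huV y s hs
  set U : (Fin n → ℝ) × ℝ → ℂ := fun p => u p.1 p.2 with hU
  have hUd : DifferentiableAt ℝ U (y, s) := (hu.differentiable (by simp)) _
  set L := fderiv ℝ U (y, s) with hL
  have hLU : HasFDerivAt U L (y, s) := hUd.hasFDerivAt
  have hus : deriv (fun s' => u y s') s = L (0, 1) := by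
    have h1 : HasDerivAt (fun s' : ℝ => (y, s')) ((0 : Fin n → ℝ), (1:ℝ)) s :=
      (hasDerivAt_const s y).prodMk (hasDerivAt_id s)
    exact (hLU.comp_hasDerivAt s h1).deriv
  have hgsm : ∀ i, ContDiff ℝ 2 (fun h : ℝ => u (Function.update y i h) s) := fun i => by
    have h1 : ContDiff ℝ 2 (fun h : ℝ => (Function.update y i h, s)) :=
      (contDiff_update 2 y i).prodMk contDiff_const
    exact (hu.of_le (WithTop.coe_le_coe.2 (le_top : (2:ℕ∞) ≤ ⊤))).comp h1
  have hgd : ∀ i, deriv (fun h : ℝ => u (Function.update y i h) s) (y i)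
      = L (Pi.single i 1, 0) := fun i => by
    have h1 : HasDerivAt (fun h : ℝ => (Function.update y i h, s))
        ((Pi.single i 1 : Fin n → ℝ), (0:ℝ)) (y i) :=
      (hasDerivAt_update y i (y i)).prodMk (hasDerivAt_const _ s)
    have hLU' : HasFDerivAt U L (Function.update y i (y i), s) := by simpa using hLU
    exact (hLU'.comp_hasDerivAt (y i) h1).deriv
  set κ : ℂ := ((α:ℂ) - β) / (4 * Complex.I * (a t : ℂ)) with hκ
  set A : ℂ := (((γ / a t) ^ ((n : ℝ) / 2) : ℝ) : ℂ) with hA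
  set Q : ℂ := ∑ i, (x i : ℂ) ^ 2 with hQ
  set E : ℂ := Complex.exp (κ * Q) with hE
  have haC : (a t : ℂ) ≠ 0 := by exact_mod_cast hat'
  have hsp : ∀ i, secondPartial n (fun x' => utld x' t) i x =
      A * E * (((γ / a t : ℝ) : ℂ)^2 * secondPartial n (fun y' => u y' s) i y
        + 4 * κ * x i * ((γ / a t : ℝ) : ℂ) * L (Pi.single i 1, 0)
        + (2 * κ + 4 * κ^2 * (x i)^2) * u y s) := fun i => by
    have hyi : y i = γ / a t * x i := by simp only [hy]; ring
    have hQi : Q = (∑ j ∈ Finset.univ.erase i, (x j : ℂ)^2) + (x i : ℂ)^2 := by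
      rw [hQ, Finset.sum_erase_add _ _ (Finset.mem_univ i)]
    have hfun : (fun h : ℝ => utld (Function.update x i h) t) = fun h : ℝ =>
        A * (fun h : ℝ => u (Function.update y i h) s) (γ / a t * h) *
          Complex.exp (κ * ((∑ j ∈ Finset.univ.erase i, (x j : ℂ)^2) + (h:ℂ)^2)) := by
      funext h
      rw [hutld]
      have e1 : (fun j => γ * Function.update x i h j / a t) =
          Function.update y i (γ / a t * h) := by
        funext j
        by_cases hj : j = i
        · subst hj; simp; ring
        · simp [hj, hy]
      have e2 : (∑ j, ((Function.update x i h j : ℝ) : ℂ)^2) =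
          (∑ j ∈ Finset.univ.erase i, (x j : ℂ)^2) + (h:ℂ)^2 := by
        rw [← Finset.sum_erase_add _ _ (Finset.mem_univ i)]
        congr 1
        · apply Finset.sum_congr rfl
          intro j hj
          rw [Function.update_of_ne (Finset.ne_of_mem_erase hj)]
        · simp
      rw [e1, e2]
      congr 2
      rw [hκ]; ring
    have := appell_oneD _ (hgsm i) (γ / a t) A κ (∑ j ∈ Finset.univ.erase i, (x j : ℂ)^2) (x i)
    rw [← hfun, ← hQi, ← hyi, hgd i] at this
    simp only [Function.update_eq_self] at this
    exact this
  have hlap : lap n (fun x' => utld x' t) x =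
      A * E * (((γ / a t : ℝ) : ℂ)^2 * lap n (fun y' => u y' s) y
        + 4 * κ * ((γ / a t : ℝ) : ℂ) * (∑ i, (x i : ℂ) * L (Pi.single i 1, 0))
        + (2 * n * κ + 4 * κ^2 * Q) * u y s) := by
    unfold lap
    rw [Finset.sum_congr rfl (fun i _ => hsp i), ← Finset.mul_sum]
    congr 1
    have e2 : (∑ i, 4 * κ * (x i : ℂ) * ((γ / a t : ℝ) : ℂ) * L (Pi.single i 1, 0)) =
        4 * κ * ((γ / a t : ℝ) : ℂ) * (∑ i, (x i : ℂ) * L (Pi.single i 1, 0)) := by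
      rw [Finset.mul_sum]
      apply Finset.sum_congr rfl
      intro i _
      ring
    have e3 : (∑ i, (2 * κ + 4 * κ^2 * (x i : ℂ)^2)) = 2 * n * κ + 4 * κ^2 * Q := by
      rw [Finset.sum_add_distrib, hQ, Finset.mul_sum]
      simp only [Finset.sum_const, Finset.card_univ, Fintype.card_fin, nsmul_eq_mul]
      ring
    rw [Finset.sum_add_distrib, Finset.sum_add_distrib, ← Finset.sum_mul, ← Finset.mul_sum,
      e2, e3]
  have hda : HasDerivAt a (β - α) t := by
    have h1 : a = fun t => α * (1 - t) + β * t := funext ha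
    rw [h1]
    have := (((hasDerivAt_id t).const_sub 1).const_mul α).add ((hasDerivAt_id t).const_mul β)
    refine this.congr_deriv ?_
    ring
  have hds : HasDerivAt (fun τ => β * τ / a τ) (γ^2 / (a t)^2) t := by
    have := ((hasDerivAt_id t).const_mul β).div hda hat'
    refine this.congr_deriv ?_
    rw [hγ2]; simp only [id]; rw [ha t]; ring
  have hdy : HasDerivAt (fun τ => (fun i => γ * x i / a τ : Fin n → ℝ))
      (fun i => (-(γ * (β - α)) / (a t)^2) * x i) t := by
    rw [hasDerivAt_pi]
    intro i
    have := (hasDerivAt_const t (γ * x i)).div hda hat'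
    refine this.congr_deriv ?_
    ring
  have hdU : HasDerivAt (fun τ => u (fun i => γ * x i / a τ) (β * τ / a τ))
      (((-(γ * (β - α)) / (a t)^2 : ℝ) : ℂ) * (∑ i, (x i : ℂ) * L (Pi.single i 1, 0))
        + ((γ^2 / (a t)^2 : ℝ) : ℂ) * L (0, 1)) t := by
    have := hLU.comp_hasDerivAt t (hdy.prodMk hds)
    refine HasDerivAt.congr_deriv (f := fun τ => u (fun i => γ * x i / a τ) (β * τ / a τ)) this ?_
    symm
    generalize (-(γ * (β - α)) / (a t)^2 : ℝ) = r
    generalize (γ^2 / (a t)^2 : ℝ) = q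
    have hv : ((fun i => r * x i : Fin n → ℝ), q) =
        r • (∑ i, x i • ((Pi.single i 1 : Fin n → ℝ), (0:ℝ))) + q • ((0 : Fin n → ℝ), (1:ℝ)) := by
      ext j
      · simp [Prod.fst_sum, Finset.sum_apply, Pi.single_apply]
      · simp [Prod.snd_sum]
    rw [hv, map_add, map_smul, map_smul, map_sum]
    simp only [map_smul, Complex.real_smul]
  have hdA : HasDerivAt (fun τ => (((γ / a τ) ^ ((n : ℝ) / 2) : ℝ) : ℂ))
      (A * (-((n:ℂ) / 2 * ((β:ℂ) - α) / a t))) t := by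
    have hb : HasDerivAt (fun τ => γ / a τ) (-(γ * (β - α)) / (a t)^2) t := by
      have := (hasDerivAt_const t γ).div hda hat'
      refine this.congr_deriv ?_
      ring
    have hpos : 0 < γ / a t := div_pos hγ0 hat
    have := (hb.rpow_const (p := (n:ℝ)/2) (Or.inl hpos.ne')).ofReal_comp
    refine this.congr_deriv ?_
    rw [Real.rpow_sub_one hpos.ne', hA]
    have hγC : (γ : ℂ) ≠ 0 := by exact_mod_cast hγ0.ne'
    push_cast
    field_simp
  have hdE : HasDerivAt (fun τ => Complex.exp (((α : ℂ) - β) * Q / (4 * Complex.I * (a τ : ℂ))))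
      (E * (-(κ * Q * ((β:ℂ) - α) / a t))) t := by
    have hne : 4 * Complex.I * (a t : ℂ) ≠ 0 := by simp [haC]
    have := ((hasDerivAt_const t (((α : ℂ) - β) * Q)).div
      (hda.ofReal_comp.const_mul (4 * Complex.I)) hne).cexp
    refine this.congr_deriv ?_
    simp only [Pi.div_apply]
    congr 1
    · rw [hE, hκ]; congr 1; ring
    · rw [hκ]; push_cast; field_simp; ring
  have hEeq : Complex.exp (((α : ℂ) - β) * Q / (4 * Complex.I * (a t : ℂ))) = E := by
    rw [hE, hκ]; congr 1; ring
  have hfin := ((hdA.mul hdU).mul hdE).deriv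
  have h1 : (fun τ => utld x τ) = ((fun τ => (((γ / a τ) ^ ((n : ℝ) / 2) : ℝ) : ℂ)) *
      fun τ => u (fun i => γ * x i / a τ) (β * τ / a τ)) *
      fun τ => Complex.exp (((α : ℂ) - β) * Q / (4 * Complex.I * (a τ : ℂ))) :=
    funext (fun τ => hutld x τ)
  rw [← h1] at hfin
  rw [hfin, hlap, hVtld, hFtld, hutld, hEeq, ← hus, heq]
  have hpow : (((γ / a t) ^ ((n : ℝ) / 2 + 2) : ℝ) : ℂ) = A * ((γ:ℂ)^2 / (a t : ℂ)^2) := by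
    have hpos : 0 < γ / a t := div_pos hγ0 hat
    rw [Real.rpow_add hpos, hA]
    push_cast
    rw [show ((2:ℝ)) = ((2:ℕ):ℝ) by norm_num, Real.rpow_natCast]
    push_cast
    rw [div_pow]
  rw [hpow, ← hγ2]
  simp only [Pi.mul_apply]
  simp only [← hy, ← hsdef, ← hA]
  have hκ' : ((α:ℂ) - β) = 4 * Complex.I * a t * κ := by
    rw [hκ]; field_simp
  have hκ'' : ((β:ℂ) - α) = -(4 * Complex.I * a t * κ) := by rw [← hκ']; ring
  push_cast
  rw [hκ'']
  generalize (∑ i, (x i : ℂ) * L (Pi.single i 1, 0)) = G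
  generalize lap n (fun y' => u y' s) y = LL
  clear_value κ A Q E
  field_simp
  ring
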